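/- Let G be a binary triorthogonal matrix of size m-by-2n that has n rows of even Hamming weight and the remaining m−n rows of odd Hamming weight, with m−n > 0. Let 𝒢₀ ⊆ F₂^{2n} denote the linear span of the even-weight rows of G. Then 𝒢₀ is not a self-dual code, i.e., 𝒢₀ ≠ 𝒢₀^⊥. -/

import Mathlib

/-- A binary matrix over `F₂ = ZMod 2` is *triorthogonal* if every pair of distinct rows has
even overlap and every triple of distinct rows has even triple overlap. -/
def Triorthogonal {m n : ℕ} (G : Matrix (Fin m) (Fin n) (ZMod 2)) : Prop :=
  (∀ a b : Fin m, a < b → ∑ j, G a j * G b j = 0) ∧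
  (∀ a b c : Fin m, a < b → b < c → ∑ j, G a j * G b j * G c j = 0)

/-- The Hamming weight of a binary vector: the number of nonzero coordinates. -/
def wt {n : ℕ} (x : Fin n → ZMod 2) : ℕ := (Finset.univ.filter fun j => x j ≠ 0).card

/-- The dual of a set of vectors in `F₂ⁿ`: all vectors with even overlap with every element. -/
def dualSet {n : ℕ} (S : Set (Fin n → ZMod 2)) : Set (Fin n → ZMod 2) :=
  {x | ∀ c ∈ S, ∑ j, x j * c j = 0}

/-- The parity of the Hamming weight is the coordinate sum. -/
lemma sum_eq_wt {n : ℕ} (x : Fin n → ZMod 2) : ∑ j, x j = (wt x : ZMod 2) := by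
  unfold wt
  rw [Finset.card_filter, Nat.cast_sum]
  refine Finset.sum_congr rfl fun j _ => ?_
  generalize x j = t
  revert t
  decide

lemma even_wt_iff {n : ℕ} (x : Fin n → ZMod 2) : Even (wt x) ↔ ∑ j, x j = 0 := by
  rw [sum_eq_wt, ZMod.natCast_eq_zero_iff_even]

/-- let `G` be a triorthogonal matrix of size `m × 2n` having exactly `n` rows of
even Hamming weight, the remaining `m - n > 0` rows being of odd weight.  Then the span `𝒢₀` of
the even-weight rows of `G` is not self-dual. -/
theorem stmt_14 {m n : ℕ} (G : Matrix (Fin m) (Fin (n + n)) (ZMod 2))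
    (hG : Triorthogonal G)
    (heven : (Finset.univ.filter fun a : Fin m => Even (wt (G a))).card = n)
    (hmn : n < m) :
    ((Submodule.span (ZMod 2) {x | ∃ a : Fin m, Even (wt (G a)) ∧ x = G a} :
        Submodule (ZMod 2) (Fin (n + n) → ZMod 2)) : Set (Fin (n + n) → ZMod 2)) ≠
      dualSet ((Submodule.span (ZMod 2) {x | ∃ a : Fin m, Even (wt (G a)) ∧ x = G a} :
        Submodule (ZMod 2) (Fin (n + n) → ZMod 2)) : Set (Fin (n + n) → ZMod 2)) := by
  intro heq
  obtain ⟨r, hr⟩ : ∃ r : Fin m, ¬ Even (wt (G r)) := by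
    by_contra! hall
    rw [Finset.filter_true_of_mem (fun a _ => hall a), Finset.card_univ, Fintype.card_fin] at heven
    omega
  have hmem : G r ∈ dualSet ((Submodule.span (ZMod 2) {x | ∃ a : Fin m, Even (wt (G a)) ∧ x = G a} :
        Submodule (ZMod 2) (Fin (n + n) → ZMod 2)) : Set (Fin (n + n) → ZMod 2)) := by
    intro c hc
    induction hc using Submodule.span_induction with
    | mem x hx =>
      obtain ⟨a, ha, rfl⟩ := hx
      rcases lt_trichotomy r a with h | h | h
      · exact hG.1 r a h
      · subst h
        exact absurd ha hr
      · rw [← hG.1 a r h]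
        exact Finset.sum_congr rfl fun j _ => mul_comm _ _
    | zero => simp
    | add x y _ _ hx hy => simp [mul_add, Finset.sum_add_distrib, hx, hy]
    | smul t x _ hx =>
      simp only [Pi.smul_apply, smul_eq_mul, mul_left_comm _ t, ← Finset.mul_sum, hx, mul_zero]
  rw [← heq] at hmem
  apply hr
  rw [even_wt_iff]
  have hmem' := SetLike.mem_coe.1 hmem
  clear hmem hr
  generalize G r = v at hmem' ⊢
  induction hmem' using Submodule.span_induction with
  | mem x hx =>
    obtain ⟨a, ha, rfl⟩ := hx
    exact (even_wt_iff _).1 ha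
  | zero => simp
  | add x y _ _ hx hy => simp [Finset.sum_add_distrib, hx, hy]
  | smul t x _ hx => simp [← Finset.mul_sum, hx]
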